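/- Corollary (database-level privacy of a PrivBench-style composite): Let a database consist of n tables T_i : Fin m_i → R_i with positive integers τ_1, …, τ_n, and let F ⊆ [n] × [n] be a set of foreign-key references. For each i ∈ [n], let A_i be a mechanism on tables Fin m_i → R_i satisfying table-level ε^s_i-DP, and for each pair (i, j) ∈ F let B_{i,j} be a mechanism on tables Fin m_i → R_i satisfying table-level ε^f_i-DP. Then for any two databases D = (T_1, …, T_n) and D' = (T_1', …, T_n') such that T_i and T_i' differ in at most τ_i coordinates for each i, and for any set S of joint outcomes, the probability that the independent composite output of all the A_i(T_i) and all the B_{i,j}(T_i) lies in S is at most exp(Σ_{i∈[n]} τ_i · ε^s_i + Σ_{(i,j)∈F} τ_i · ε^f_i) times the corresponding probability on D'. -/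

import Mathlib

open MeasureTheory

/-- Two tables (functions on an index type) differ in at most `τ` coordinates. -/
def DiffAtMost {ι R : Type*} (τ : ℕ) (T T' : ι → R) : Prop :=
  ∃ s : Finset ι, s.card ≤ τ ∧ ∀ i ∉ s, T i = T' i

/-- A randomized mechanism mapping tables to PMFs satisfies table-level `ε`-DP
(bounded interpretation: neighboring tables differ in at most one coordinate). -/
def IsDP {ι R Ω : Type*} (M : (ι → R) → PMF Ω) (ε : ℝ) : Prop :=
  ∀ T T' : ι → R, DiffAtMost 1 T T' → ∀ S : Set Ω,
    (M T).toOuterMeasure S ≤ ENNReal.ofReal (Real.exp ε) * (M T').toOuterMeasure S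

/-- Group privacy: an `ε`-DP mechanism is `k * ε`-indistinguishable on tables that differ in at
most `k` coordinates. -/
theorem IsDP.group_privacy {ι R Ω : Type*} {M : (ι → R) → PMF Ω} {ε : ℝ} (hM : IsDP M ε)
    (k : ℕ) {T T' : ι → R} (h : DiffAtMost k T T') (S : Set Ω) :
    (M T).toOuterMeasure S
      ≤ ENNReal.ofReal (Real.exp (k * ε)) * (M T').toOuterMeasure S := by
  classical
  induction k generalizing T with
  | zero =>
    obtain ⟨s, hs, h⟩ := h
    have hs' : s = ∅ := by simpa using hs
    have hT : T = T' := funext fun i => h i (by simp [hs'])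
    simp [hT]
  | succ k ih =>
    obtain ⟨s, hs, h⟩ := h
    obtain ⟨U, hTU, hUT'⟩ : ∃ U, DiffAtMost 1 T U ∧ DiffAtMost k U T' := by
      rcases s.eq_empty_or_nonempty with rfl | ⟨a, ha⟩
      · exact ⟨T, ⟨∅, by simp, fun _ _ => rfl⟩, ∅, by simp, h⟩
      · refine ⟨Function.update T a (T' a), ⟨{a}, by simp, fun i hi => ?_⟩,
          s.erase a, by rw [Finset.card_erase_of_mem ha]; omega, fun i hi => ?_⟩
        · rw [Function.update_of_ne (by simpa using hi)]
        · rcases eq_or_ne i a with rfl | hia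
          · simp
          · rw [Function.update_of_ne hia]
            exact h i fun his => hi (Finset.mem_erase.2 ⟨hia, his⟩)
    calc (M T).toOuterMeasure S
        ≤ ENNReal.ofReal (Real.exp ε) * (M U).toOuterMeasure S := hM T U hTU S
      _ ≤ ENNReal.ofReal (Real.exp ε) *
          (ENNReal.ofReal (Real.exp (k * ε)) * (M T').toOuterMeasure S) := by
        gcongr
        exact ih hUT'
      _ = ENNReal.ofReal (Real.exp ((k + 1 : ℕ) * ε)) * (M T').toOuterMeasure S := by
        rw [← mul_assoc, ← ENNReal.ofReal_mul (Real.exp_pos _).le, ← Real.exp_add]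
        congr 3
        push_cast
        ring

theorem IsDP.toMeasure_le {ι R Ω : Type*} [MeasurableSpace Ω] {M : (ι → R) → PMF Ω} {ε : ℝ}
    (hM : IsDP M ε) (k : ℕ) {T T' : ι → R} (h : DiffAtMost k T T') :
    (M T).toMeasure ≤ ENNReal.ofReal (Real.exp (k * ε)) • (M T').toMeasure := by
  refine Measure.le_iff.2 fun s hs => ?_
  rw [Measure.smul_apply, smul_eq_mul, PMF.toMeasure_apply_eq_toOuterMeasure_apply _ hs,
    PMF.toMeasure_apply_eq_toOuterMeasure_apply _ hs]
  exact hM.group_privacy k h s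

theorem MeasureTheory.Measure.pi_le_pi {ι : Type*} [Fintype ι] {α : ι → Type*}
    [∀ i, MeasurableSpace (α i)] {μ ν : ∀ i, Measure (α i)} [∀ i, SigmaFinite (μ i)]
    (h : ∀ i, μ i ≤ ν i) : Measure.pi μ ≤ Measure.pi ν := by
  refine Measure.le_iff.2 fun s hs => ?_
  rw [Measure.pi_def ν, toMeasure_apply _ _ hs]
  suffices (Measure.pi μ).toOuterMeasure ≤ OuterMeasure.pi fun i => (ν i).toOuterMeasure from
    this s
  rw [OuterMeasure.le_pi]
  intro t _
  exact (Measure.pi_pi μ t).trans_le (Finset.prod_le_prod' fun i _ => h i (t i))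

/-- Finite products of measures that are dominated up to the factors `exp (c i)` are dominated up
to the factor `exp (∑ i, c i)`. -/
theorem MeasureTheory.Measure.pi_le_exp_sum_smul_pi {ι : Type*} [Fintype ι] {α : ι → Type*}
    [∀ i, MeasurableSpace (α i)] {μ ν : ∀ i, Measure (α i)} [∀ i, SigmaFinite (μ i)]
    [∀ i, IsFiniteMeasure (ν i)] (c : ι → ℝ)
    (h : ∀ i, μ i ≤ ENNReal.ofReal (Real.exp (c i)) • ν i) :
    Measure.pi μ ≤ ENNReal.ofReal (Real.exp (∑ i, c i)) • Measure.pi ν := by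
  have hfin (i : ι) : IsFiniteMeasure (ENNReal.ofReal (Real.exp (c i)) • ν i) :=
    (ν i).smul_finite ENNReal.ofReal_ne_top
  refine (Measure.pi_le_pi h).trans_eq (Measure.pi_eq fun s _ => ?_)
  simp_rw [Measure.smul_apply, smul_eq_mul, Measure.pi_pi, Finset.prod_mul_distrib]
  rw [Real.exp_sum, ENNReal.ofReal_prod_of_nonneg fun i _ => (Real.exp_pos _).le]

/-- Database-level privacy of a PrivBench-style composite: for each table `T i`
an SPN-construction mechanism `A i` that is `εs i`-DP is run, and for each
foreign-key reference `(i, j) ∈ F` a fanout mechanism `B (i,j)` that is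
`εf i`-DP is run on table `T i`; all outputs are published jointly and
independently. On databases whose `i`-th tables differ in at most `τ i` rows,
the composite is `(∑ i, τ i · εs i + ∑ (i,j) ∈ F, τ i · εf i)`-indistinguishable. -/
theorem privbench_database_level_dp {n : ℕ} {m : Fin n → ℕ} {R : Fin n → Type*}
    (F : Finset (Fin n × Fin n))
    {ΩA : Fin n → Type*} [∀ i, MeasurableSpace (ΩA i)]
    {ΩB : F → Type*} [∀ p, MeasurableSpace (ΩB p)]
    (τ : Fin n → ℕ) (hτ : ∀ i, 0 < τ i) (εs εf : Fin n → ℝ)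
    (A : (i : Fin n) → ((Fin (m i) → R i) → PMF (ΩA i)))
    (hA : ∀ i, IsDP (A i) (εs i))
    (B : (p : F) → ((Fin (m p.1.1) → R p.1.1) → PMF (ΩB p)))
    (hB : ∀ p, IsDP (B p) (εf p.1.1))
    (D D' : (i : Fin n) → Fin (m i) → R i)
    (hD : ∀ i, DiffAtMost (τ i) (D i) (D' i))
    (S : Set (((i : Fin n) → ΩA i) × ((p : F) → ΩB p))) :
    (Measure.pi fun i => (A i (D i)).toMeasure).prod
        (Measure.pi fun p : F => (B p (D p.1.1)).toMeasure) S
      ≤ ENNReal.ofReal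
          (Real.exp (∑ i, (τ i : ℝ) * εs i + ∑ p ∈ F, (τ p.1 : ℝ) * εf p.1)) *
        (Measure.pi fun i => (A i (D' i)).toMeasure).prod
          (Measure.pi fun p : F => (B p (D' p.1.1)).toMeasure) S := by
  have hA' := Measure.pi_le_exp_sum_smul_pi (fun i => (τ i : ℝ) * εs i)
    fun i => (hA i).toMeasure_le (τ i) (hD i)
  have hB' := Measure.pi_le_exp_sum_smul_pi (fun p : F => (τ p.1.1 : ℝ) * εf p.1.1)
    fun p => (hB p).toMeasure_le (τ p.1.1) (hD p.1.1)
  rw [Finset.sum_coe_sort F fun p => (τ p.1 : ℝ) * εf p.1] at hB'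
  refine (Measure.prod_mono hA' hB' S).trans_eq ?_
  rw [Measure.prod_smul_left, Measure.prod_smul_right, smul_smul, Measure.smul_apply,
    smul_eq_mul, ← ENNReal.ofReal_mul (Real.exp_pos _).le, ← Real.exp_add]
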